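/- Under the Hölder-like condition, for any x₀ ∈ B(x*, r) with x₀ ≠ x*, setting t₀ = ‖x₀ − x*‖ and t_{k+1} = K p t_k^{p+1} / ((p+1)(1 − K t_k^p)), the Newton sequence x_{k+1} = x_k − F'(x_k)^{-1} F(x_k) satisfies ‖x_{k+1} − x*‖ ≤ [K p / ((p+1)(1 − K t_k^p))] · ‖x_k − x*‖^{p+1} for all k = 0, 1, 2, …. -/

import Mathlib

open Filter Metric Set Topology

/-- A Banach space operator which is close to an invertible one, measured through the inverse `B`
of the latter, is invertible. -/
lemma exists_inverse_of_norm_comp_sub_lt_one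
    {X Y : Type*} [NormedAddCommGroup X] [NormedSpace ℝ X] [CompleteSpace X]
    [NormedAddCommGroup Y] [NormedSpace ℝ Y]
    {A A₀ : X →L[ℝ] Y} {B : Y →L[ℝ] X}
    (hB1 : B.comp A₀ = ContinuousLinearMap.id ℝ X)
    (hB2 : A₀.comp B = ContinuousLinearMap.id ℝ Y)
    (h : ‖B.comp (A - A₀)‖ < 1) :
    ∃ G : Y →L[ℝ] X, G.comp A = ContinuousLinearMap.id ℝ X ∧
      A.comp G = ContinuousLinearMap.id ℝ Y := by
  have hE : IsUnit (1 - -(B.comp (A - A₀))) :=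
    isUnit_one_sub_of_norm_lt_one (by rwa [norm_neg])
  have hBA : 1 - -(B.comp (A - A₀)) = B.comp A := by
    rw [ContinuousLinearMap.comp_sub, hB1, ContinuousLinearMap.one_def]
    abel
  rw [hBA] at hE
  obtain ⟨V, hV1, hV2⟩ := isUnit_iff_exists.mp hE
  have h₀ (y : Y) : A₀ (B y) = y := congrArg (fun T : Y →L[ℝ] Y => T y) hB2
  have hr (x : X) : B (A (V x)) = x := congrArg (fun T : X →L[ℝ] X => T x) hV1
  have hl (x : X) : V (B (A x)) = x := congrArg (fun T : X →L[ℝ] X => T x) hV2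
  refine ⟨V.comp B, ContinuousLinearMap.ext hl, ContinuousLinearMap.ext fun y => ?_⟩
  have := hr (B y)
  change A (V (B y)) = y
  rw [← h₀ (A (V (B y))), this, h₀]

/-- The linearisation error of `F` at `x`, under a radial Hölder condition on the derivative. -/
lemma norm_linearization_error_le
    {X Y : Type*} [NormedAddCommGroup X] [NormedSpace ℝ X]
    [NormedAddCommGroup Y] [NormedSpace ℝ Y]
    {F : X → Y} {F' : X → X →L[ℝ] Y} {B : Y →L[ℝ] X} {xs x : X} {K p : ℝ} (hp0 : 0 < p)
    (hF : ∀ τ ∈ Icc (0 : ℝ) 1, HasFDerivAt F (F' (xs + τ • (x - xs))) (xs + τ • (x - xs)))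
    (hFxs : F xs = 0)
    (hHol : ∀ τ ∈ Icc (0 : ℝ) 1,
      ‖B.comp (F' x - F' (xs + τ • (x - xs)))‖ ≤ K * (1 - τ ^ p) * ‖x - xs‖ ^ p) :
    ‖B (F' x (x - xs) - F x)‖ ≤ K * p / (p + 1) * ‖x - xs‖ ^ (p + 1) := by
  have hp : p + 1 ≠ 0 := by positivity
  have hg (τ : ℝ) (hτ : τ ∈ Icc (0 : ℝ) 1) :
      HasDerivAt (fun τ : ℝ => B (τ • F' x (x - xs) - F (xs + τ • (x - xs))))
        (B (F' x (x - xs) - F' (xs + τ • (x - xs)) (x - xs))) τ := by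
    have hline : HasDerivAt (fun τ : ℝ => xs + τ • (x - xs)) (x - xs) τ := by
      simpa using ((hasDerivAt_id τ).smul_const (x - xs)).const_add xs
    have hlin : HasDerivAt (fun τ : ℝ => τ • F' x (x - xs)) (F' x (x - xs)) τ := by
      simpa using (hasDerivAt_id τ).smul_const (F' x (x - xs))
    exact B.hasFDerivAt.comp_hasDerivAt τ (hlin.sub ((hF τ hτ).comp_hasDerivAt τ hline))
  have hb (τ : ℝ) : HasDerivAt
      (fun τ : ℝ => K * ‖x - xs‖ ^ (p + 1) * (τ - τ ^ (p + 1) / (p + 1)))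
      (K * ‖x - xs‖ ^ (p + 1) * (1 - τ ^ p)) τ := by
    have := ((hasDerivAt_id τ).sub ((Real.hasDerivAt_rpow_const (x := τ) (p := p + 1)
      (Or.inr (by linarith))).div_const (p + 1))).const_mul (K * ‖x - xs‖ ^ (p + 1))
    simpa [hp, mul_div_cancel_left₀] using this
  have key := image_norm_le_of_norm_deriv_right_le_deriv_boundary
    (a := (0 : ℝ)) (b := 1)
    (fun τ hτ => (hg τ hτ).continuousAt.continuousWithinAt)
    (fun τ hτ => (hg τ (Ico_subset_Icc_self hτ)).hasDerivWithinAt)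
    (by simp [hFxs, Real.zero_rpow hp]) hb
    (fun τ hτ => by
      have h1 := (B.comp (F' x - F' (xs + τ • (x - xs)))).le_opNorm (x - xs)
      have h2 := mul_le_mul_of_nonneg_right (hHol τ (Ico_subset_Icc_self hτ))
        (norm_nonneg (x - xs))
      have h3 : ‖x - xs‖ ^ (p + 1) = ‖x - xs‖ ^ p * ‖x - xs‖ :=
        Real.rpow_add_one' (norm_nonneg _) hp
      refine (h1.trans h2).trans (le_of_eq ?_)
      rw [h3]
      ring)
    (right_mem_Icc.mpr zero_le_one)
  simp only [one_smul, Real.one_rpow, add_sub_cancel] at key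
  refine key.trans (le_of_eq ?_)
  field_simp
  ring

/-- One Newton step under a radial Hölder condition on the derivative. -/
lemma exists_newton_step
    {X Y : Type*} [NormedAddCommGroup X] [NormedSpace ℝ X] [CompleteSpace X]
    [NormedAddCommGroup Y] [NormedSpace ℝ Y]
    {F : X → Y} {F' : X → X →L[ℝ] Y} {B : Y →L[ℝ] X} {xs x : X} {K p : ℝ} (hp0 : 0 < p)
    (hB1 : B.comp (F' xs) = ContinuousLinearMap.id ℝ X)
    (hB2 : (F' xs).comp B = ContinuousLinearMap.id ℝ Y)
    (hF : ∀ τ ∈ Icc (0 : ℝ) 1, HasFDerivAt F (F' (xs + τ • (x - xs))) (xs + τ • (x - xs)))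
    (hFxs : F xs = 0)
    (hHol : ∀ τ ∈ Icc (0 : ℝ) 1,
      ‖B.comp (F' x - F' (xs + τ • (x - xs)))‖ ≤ K * (1 - τ ^ p) * ‖x - xs‖ ^ p)
    (hx : K * ‖x - xs‖ ^ p < 1) :
    ∃ y : X, (∃ G : Y →L[ℝ] X, G.comp (F' x) = ContinuousLinearMap.id ℝ X ∧
        (F' x).comp G = ContinuousLinearMap.id ℝ Y ∧ y = x - G (F x)) ∧
      ‖y - xs‖ ≤ (K * p / ((p + 1) * (1 - K * ‖x - xs‖ ^ p))) * ‖x - xs‖ ^ (p + 1) := by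
  have hE : ‖B.comp (F' x - F' xs)‖ ≤ K * ‖x - xs‖ ^ p := by
    simpa [Real.zero_rpow hp0.ne'] using hHol 0 (left_mem_Icc.mpr zero_le_one)
  obtain ⟨G, hG1, hG2⟩ := exists_inverse_of_norm_comp_sub_lt_one hB1 hB2 (hE.trans_lt hx)
  refine ⟨x - G (F x), ⟨G, hG1, hG2, rfl⟩, ?_⟩
  set e := x - G (F x) - xs with he
  have hlin := norm_linearization_error_le hp0 hF hFxs hHol
  have hAe : F' x (x - xs) - F x = F' x e := by
    have hG (y : Y) : F' x (G y) = y := congrArg (fun T : Y →L[ℝ] Y => T y) hG2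
    rw [he, sub_right_comm, map_sub _ _ (G (F x)), hG]
  have hBe : B (F' xs e) = e := congrArg (fun T : X →L[ℝ] X => T e) hB1
  rw [hAe] at hlin
  have hle : ‖e‖ ≤ ‖B (F' x e)‖ + K * ‖x - xs‖ ^ p * ‖e‖ := by
    have h1 := (B.comp (F' x - F' xs)).le_of_opNorm_le hE e
    have h2 : e = B (F' x e) - B.comp (F' x - F' xs) e := by simp [hBe]
    calc ‖e‖ = ‖B (F' x e) - B.comp (F' x - F' xs) e‖ := congrArg _ h2
      _ ≤ _ := (norm_sub_le _ _).trans (by gcongr)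
  rw [← div_div, div_mul_eq_mul_div, le_div_iff₀ (by linarith)]
  linarith

lemma ball_sSup_subset {X : Type*} [PseudoMetricSpace X] (x : X) {Ω : Set X} {R : ℝ}
    (hR : 0 < R) : ball x (sSup {t | t ∈ Ico 0 R ∧ ball x t ⊆ Ω}) ⊆ Ω := by
  intro y hy
  have hne : {t | t ∈ Ico 0 R ∧ ball x t ⊆ Ω}.Nonempty := ⟨0, ⟨le_rfl, hR⟩, by simp⟩
  obtain ⟨t, ⟨-, ht⟩, hyt⟩ := exists_lt_of_lt_csSup hne (mem_ball.mp hy)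
  exact ht hyt

/-- The scalar majorizing iteration decreases as long as its argument is small. -/
lemma majorizing_step_le {K p t : ℝ} (hK : 0 < K) (hp0 : 0 < p) (ht : 0 ≤ t)
    (h : K * t ^ p < (p + 1) / (2 * p + 1)) :
    K * p * t ^ (p + 1) / ((p + 1) * (1 - K * t ^ p)) ≤ t := by
  rw [lt_div_iff₀ (by positivity)] at h
  have h1 : K * t ^ p < 1 := by
    have : 0 ≤ K * t ^ p := by positivity
    nlinarith
  rw [div_le_iff₀ (mul_pos (by positivity) (by linarith)), Real.rpow_add_one' ht (by positivity)]
  nlinarith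

theorem stmt15
    {X Y : Type*} [NormedAddCommGroup X] [NormedSpace ℝ X] [CompleteSpace X]
    [NormedAddCommGroup Y] [NormedSpace ℝ Y] [CompleteSpace Y]
    (Ω : Set X) (hΩ : IsOpen Ω)
    (F : X → Y) (F' : X → X →L[ℝ] Y)
    (hF : ∀ x ∈ Ω, HasFDerivAt F (F' x) x)
    (hF'c : ContinuousOn F' Ω)
    (xs : X) (hxs : xs ∈ Ω) (hFxs : F xs = 0)
    (B : Y →L[ℝ] X)
    (hB1 : B.comp (F' xs) = ContinuousLinearMap.id ℝ X)
    (hB2 : (F' xs).comp B = ContinuousLinearMap.id ℝ Y)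
    (R : ℝ) (hR : 0 < R)
    (κ : ℝ) (hκ : κ = sSup {t | t ∈ Ico 0 R ∧ ball xs t ⊆ Ω})
    (K p : ℝ) (hK : 0 < K) (hp0 : 0 < p) (hp1 : p ≤ 1)
    (hHol : ∀ x ∈ ball xs κ, ∀ τ ∈ Icc (0:ℝ) 1,
      ‖B.comp (F' x - F' (xs + τ • (x - xs)))‖ ≤ K * (1 - τ ^ p) * ‖x - xs‖ ^ p)
    (r : ℝ) (hr : r = min κ (((p+1) / ((2*p+1) * K)) ^ (1/p)))
    : ∀ x₀ ∈ ball xs r, x₀ ≠ xs →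
      ∀ t : ℕ → ℝ, t 0 = ‖x₀ - xs‖ →
      (∀ k, t (k+1) = K * p * t k ^ (p+1) / ((p+1) * (1 - K * t k ^ p))) →
      ∃ x : ℕ → X, x 0 = x₀ ∧
        (∀ k, ∃ G : Y →L[ℝ] X, G.comp (F' (x k)) = ContinuousLinearMap.id ℝ X ∧
          (F' (x k)).comp G = ContinuousLinearMap.id ℝ Y ∧
          x (k+1) = x k - G (F (x k))) ∧
        (∀ k, ‖x (k+1) - xs‖ ≤
          (K * p / ((p+1) * (1 - K * t k ^ p))) * ‖x k - xs‖ ^ (p+1)) := by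
  intro x₀ hx₀ _ t ht0 ht
  have hκΩ : ball xs κ ⊆ Ω := hκ ▸ ball_sSup_subset xs hR
  have hrκ : r ≤ κ := hr ▸ min_le_left _ _
  have hsmall {s : ℝ} (hs : 0 ≤ s) (hsr : s < r) : K * s ^ p < (p + 1) / (2 * p + 1) := by
    have h := Real.rpow_lt_rpow hs (hsr.trans_le (hr.trans_le (min_le_right _ _))) hp0
    rw [one_div, Real.rpow_inv_rpow (by positivity) hp0.ne', ← div_div,
      lt_div_iff₀ hK] at h
    rwa [mul_comm]
  have hlt1 {s : ℝ} (hs : 0 ≤ s) (hsr : s < r) : K * s ^ p < 1 :=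
    (hsmall hs hsr).trans ((div_lt_one (by positivity)).mpr (by linarith))
  have hstep (x : X) (hx : x ∈ ball xs r) := exists_newton_step (F := F) (x := x) hp0 hB1 hB2
    (fun τ hτ => hF _ (hκΩ ((convex_ball xs κ).add_smul_sub_mem
      (mem_ball_self (dist_nonneg.trans_lt (ball_subset_ball hrκ hx)))
      (ball_subset_ball hrκ hx) hτ)))
    hFxs (hHol x (ball_subset_ball hrκ hx))
    (hlt1 (norm_nonneg _) (mem_ball_iff_norm.mp hx))
  choose! f hfG hf using hstep
  have hbound {x : X} {s : ℝ} (hxs : ‖x - xs‖ ≤ s) (hsr : s < r) :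
      ‖f x - xs‖ ≤ (K * p / ((p + 1) * (1 - K * s ^ p))) * ‖x - xs‖ ^ (p + 1) := by
    have h1 := hlt1 ((norm_nonneg _).trans hxs) hsr
    have h2 : 0 < 1 - K * s ^ p := by linarith
    refine (hf x (mem_ball_iff_norm.mpr (hxs.trans_lt hsr))).trans ?_
    gcongr
  have hinv (k : ℕ) : ‖f^[k] x₀ - xs‖ ≤ t k ∧ t k < r := by
    induction k with
    | zero => exact ⟨ht0.ge, ht0 ▸ mem_ball_iff_norm.mp hx₀⟩
    | succ k ih =>
      obtain ⟨hle, hlt⟩ := ih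
      have htk : 0 ≤ t k := (norm_nonneg _).trans hle
      have h2 : 0 < 1 - K * t k ^ p := by linarith [hlt1 htk hlt]
      rw [ht k, Function.iterate_succ_apply']
      refine ⟨(hbound hle hlt).trans ?_,
        (majorizing_step_le hK hp0 htk (hsmall htk hlt)).trans_lt hlt⟩
      rw [← div_mul_eq_mul_div (K * p)]
      gcongr
  refine ⟨fun k => f^[k] x₀, rfl, fun k => ?_, fun k => ?_⟩
  · simp only [Function.iterate_succ_apply']
    exact hfG _ (mem_ball_iff_norm.mpr ((hinv k).1.trans_lt (hinv k).2))
  · simp only [Function.iterate_succ_apply']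
    exact hbound (hinv k).1 (hinv k).2
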